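/- Every square complex matrix is congruent to a direct sum of matrices of the three forms: a nilpotent Jordan block J_n(0), the matrix Γ_n (the n×n matrix with alternating ±1 on the anti-diagonal and the adjacent diagonal as defined), and the 2n×2n matrix [[0, I_n],[J_n(λ), 0]] with λ ≠ 0 and λ ≠ (−1)^{n+1}. -/

import Mathlib

open Matrix

/-- The `n × n` Jordan block with eigenvalue `a`. -/
noncomputable def Jb (n : ℕ) (a : ℂ) : Matrix (Fin n) (Fin n) ℂ :=
  Matrix.of fun i j => if (i : ℕ) + 1 = (j : ℕ) then 1 else if i = j then a else 0

/-- The matrix `Γ_n` with alternating `±1` on the anti-diagonal and the adjacent diagonal. -/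
noncomputable def Gam (n : ℕ) : Matrix (Fin n) (Fin n) ℂ :=
  Matrix.of fun i j =>
    if (i : ℕ) + (j : ℕ) + 1 = n ∨ ((i : ℕ) + (j : ℕ) = n ∧ 1 ≤ (i : ℕ)) then
      (-1 : ℂ) ^ (n - 1 - (i : ℕ)) else 0

/-- The `2n × 2n` matrix `[[0, I_n],[J_n(μ), 0]]`. -/
noncomputable def PairBlk (n : ℕ) (μ : ℂ) : Matrix (Fin (n + n)) (Fin (n + n)) ℂ :=
  Matrix.reindex finSumFinEquiv finSumFinEquiv (Matrix.fromBlocks 0 1 (Jb n μ) 0)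

universe u

section CongruenceCriterion

open Polynomial in
/-- `X` is a square modulo every polynomial with nonzero roots. -/
theorem exists_prod_dvd_sq_sub_X (s : Multiset ℂ) (hs : (0 : ℂ) ∉ s) :
    ∃ p : ℂ[X], (s.map fun a => X - C a).prod ∣ p ^ 2 - X := by
  induction s using Multiset.induction_on with
  | empty => exact ⟨0, by simp⟩
  | cons a s ih =>
    obtain ⟨p, h, hp⟩ := ih fun h => hs (Multiset.mem_cons_of_mem h)
    have ha : a ≠ 0 := fun h => hs (h ▸ Multiset.mem_cons_self a s)
    set f : ℂ[X] := (s.map fun a => X - C a).prod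
    obtain ⟨c, hc⟩ : ∃ c : ℂ, f.eval a * c ^ 2 + 2 * p.eval a * c + h.eval a = 0 := by
      have hpa : p.eval a ^ 2 - a = f.eval a * h.eval a := by
        simpa using congrArg (Polynomial.eval a) hp
      by_cases hf : f.eval a = 0
      · have hpa' : p.eval a ≠ 0 := by
          intro h0
          simp [h0, hf] at hpa
          exact ha hpa
        exact ⟨-h.eval a / (2 * p.eval a), by rw [hf]; field_simp; ring⟩
      · obtain ⟨r, hr⟩ := IsAlgClosed.exists_eq_mul_self
          (discrim (f.eval a) (2 * p.eval a) (h.eval a))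
        obtain ⟨c, hc⟩ := exists_quadratic_eq_zero hf ⟨r, hr⟩
        exact ⟨c, by rw [← hc]; ring⟩
    obtain ⟨k, hk⟩ := Polynomial.dvd_iff_isRoot.2
      (show (h + 2 * C c * p + C c ^ 2 * f).IsRoot a by
        rw [Polynomial.IsRoot, ← hc]; simp; ring)
    refine ⟨p + C c * f, k, ?_⟩
    rw [Multiset.map_cons, Multiset.prod_cons]
    linear_combination hp + f * hk

variable {κ : Type*} [Fintype κ] [DecidableEq κ]

open Polynomial in
/-- An invertible complex matrix has a square root which is a polynomial in it. -/
theorem exists_aeval_sq_eq (Q : Matrix κ κ ℂ) (hQ : IsUnit Q) :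
    ∃ p : ℂ[X], aeval Q p ^ 2 = Q := by
  have h0 : (0 : ℂ) ∉ Q.charpoly.roots := by
    intro h
    have h1 := (Polynomial.mem_roots'.1 h).2
    rw [Polynomial.IsRoot, ← Polynomial.coeff_zero_eq_eval_zero] at h1
    have h2 := Matrix.det_eq_sign_charpoly_coeff Q
    rw [h1, mul_zero] at h2
    exact ((Matrix.isUnit_iff_isUnit_det Q).1 hQ).ne_zero h2
  obtain ⟨p, k, hp⟩ := exists_prod_dvd_sq_sub_X _ h0
  refine ⟨p, ?_⟩
  rw [← (IsAlgClosed.splits Q.charpoly).eq_prod_roots_of_monic (Matrix.charpoly_monic Q)] at hp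
  have := congrArg (aeval Q) hp
  simpa [Matrix.aeval_self_charpoly, sub_eq_zero] using this

/-- Two invertible matrices with the same cosquare (encoded by the pair `X, Y`) are congruent. -/
theorem exists_congruent_of_cosquare_eq {G H X Y : Matrix κ κ ℂ} (hG : IsUnit G) (hH : IsUnit H)
    (hY : IsUnit Y) (hGX : Gᵀ * X = G * Y) (hHX : Hᵀ * X = H * Y) :
    ∃ S : Matrix κ κ ℂ, IsUnit S ∧ Sᵀ * G * S = H := by
  obtain ⟨g, rfl⟩ := hG
  obtain ⟨Q, rfl⟩ : ∃ Q, H = g * Q := ⟨(g⁻¹ : _ˣ) * H, by simp⟩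
  have hQ : IsUnit Q := by simpa using hH
  have hsa : Qᵀ * (g : Matrix κ κ ℂ) = g * Q := by
    apply hY.mul_right_cancel
    rw [← hHX, Matrix.transpose_mul, Matrix.mul_assoc, Matrix.mul_assoc, hGX]
  obtain ⟨p, hp⟩ := exists_aeval_sq_eq Q hQ
  have hS (p : Polynomial ℂ) : (Polynomial.aeval Q p)ᵀ * (g : Matrix κ κ ℂ) =
      g * Polynomial.aeval Q p := by
    induction p using Polynomial.induction_on' with
    | add p q hp hq => rw [map_add, Matrix.transpose_add, Matrix.add_mul, Matrix.mul_add, hp, hq]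
    | monomial n a =>
      have : SemiconjBy (g : Matrix κ κ ℂ) Q Qᵀ := hsa.symm
      rw [Polynomial.aeval_monomial, ← Algebra.smul_def, Matrix.transpose_smul,
        Matrix.transpose_pow, Matrix.smul_mul, Matrix.mul_smul, (this.pow_right n).eq]
  refine ⟨Polynomial.aeval Q p, ?_, ?_⟩
  · rw [← hp] at hQ
    exact (isUnit_pow_iff two_ne_zero).1 hQ
  · rw [hS, Matrix.mul_assoc, ← sq, hp]

end CongruenceCriterion

/-- The canonical blocks for congruence. -/
def IsCanonicalBlock {n : ℕ} (M : Matrix (Fin n) (Fin n) ℂ) : Prop :=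
  M = Jb n 0 ∨ M = Gam n ∨
    ∃ (m : ℕ) (μ : ℂ) (h : m + m = n), μ ≠ 0 ∧ μ ≠ (-1 : ℂ) ^ (m + 1) ∧
      M = Matrix.reindex (finCongr h) (finCongr h) (PairBlk m μ)

section Gluing

variable {V : Type*} [AddCommGroup V] [Module ℂ V]

/-- The bilinear form `B` has a basis in which its Gram matrix is a direct sum of canonical
blocks. -/
def HasCanonicalBasis (B : V →ₗ[ℂ] V →ₗ[ℂ] ℂ) : Prop :=
  ∃ (ι : Type) (_ : Fintype ι) (d : ι → ℕ) (Bk : ∀ i, Matrix (Fin (d i)) (Fin (d i)) ℂ)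
    (b : Module.Basis ((i : ι) × Fin (d i)) ℂ V),
    (∀ i p q, B (b ⟨i, p⟩) (b ⟨i, q⟩) = Bk i p q) ∧
    (∀ i j p q, i ≠ j → B (b ⟨i, p⟩) (b ⟨j, q⟩) = 0) ∧
    ∀ i, IsCanonicalBlock (Bk i)

/-- Adding one summand to a sigma type of `Fin`s. -/
def sigmaOptionElimEquiv {ι : Type} (n : ℕ) (d : ι → ℕ) :
    (Fin n ⊕ (i : ι) × Fin (d i)) ≃ ((o : Option ι) × Fin (o.elim n d)) where
  toFun := Sum.elim (fun p => ⟨none, p⟩) (fun x => ⟨some x.1, x.2⟩)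
  invFun
    | ⟨none, p⟩ => Sum.inl p
    | ⟨some i, p⟩ => Sum.inr ⟨i, p⟩
  left_inv := by rintro (p | ⟨i, p⟩) <;> rfl
  right_inv := by rintro ⟨_ | i, p⟩ <;> rfl

/-- A family with a dual family of functionals spans a complement of their common kernel. -/
theorem exists_basis_sum_of_dual {κ σ : Type*} [Fintype κ] [DecidableEq κ]
    (e : κ → V) (φ : κ → Module.Dual ℂ V) (hφ : ∀ i j, φ i (e j) = if i = j then 1 else 0)
    (b : Module.Basis σ ℂ (⨅ i, LinearMap.ker (φ i) : Submodule ℂ V)) :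
    ∃ c : Module.Basis (κ ⊕ σ) ℂ V, (∀ i, c (Sum.inl i) = e i) ∧ ∀ i, c (Sum.inr i) = b i := by
  have hli : LinearIndependent ℂ e := by
    rw [Fintype.linearIndependent_iff]
    intro g hg i
    simpa [hφ] using congrArg (φ i) hg
  have hc : IsCompl (Submodule.span ℂ (Set.range e)) (⨅ i, LinearMap.ker (φ i)) := by
    constructor
    · rw [Submodule.disjoint_def]
      intro x hx hx'
      obtain ⟨g, rfl⟩ := (Submodule.mem_span_range_iff_exists_fun ℂ).1 hx
      refine Finset.sum_eq_zero fun i _ => ?_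
      have := (Submodule.mem_iInf _).1 hx' i
      simp [hφ] at this
      simp [this]
    · rw [codisjoint_iff, eq_top_iff]
      intro x _
      rw [Submodule.mem_sup]
      refine ⟨∑ i, φ i x • e i, (Submodule.mem_span_range_iff_exists_fun ℂ).2 ⟨_, rfl⟩,
        x - ∑ i, φ i x • e i, ?_, by simp⟩
      rw [Submodule.mem_iInf]
      intro i
      simp [hφ]
  refine ⟨((Module.Basis.span hli).prod b).map (Submodule.prodEquivOfIsCompl _ _ hc), ?_, ?_⟩
  · intro i
    simp [Module.Basis.span_apply]
  · intro i
    simp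

/-- A canonical block whose dual functionals cut out a biorthogonal complement can be split
off. -/
theorem HasCanonicalBasis.of_split {B : V →ₗ[ℂ] V →ₗ[ℂ] ℂ} {n : ℕ}
    (e : Fin n → V) (φ : Fin n → Module.Dual ℂ V)
    (hφ : ∀ i j, φ i (e j) = if i = j then 1 else 0)
    (horth : ∀ v, (∀ i, φ i v = 0) → ∀ j, B (e j) v = 0 ∧ B v (e j) = 0)
    (hblk : IsCanonicalBlock (Matrix.of fun i j => B (e i) (e j)))
    (hW : HasCanonicalBasis (B.domRestrict₁₂ (⨅ i, LinearMap.ker (φ i) : Submodule ℂ V)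
      (⨅ i, LinearMap.ker (φ i) : Submodule ℂ V))) :
    HasCanonicalBasis B := by
  obtain ⟨ι, hι, d, Bk, b, hb, hb', hBk⟩ := hW
  obtain ⟨c, hc, hc'⟩ := exists_basis_sum_of_dual e φ hφ b
  have horth' (x : (⨅ i, LinearMap.ker (φ i) : Submodule ℂ V)) (j) :
      B (e j) x = 0 ∧ B x (e j) = 0 :=
    horth x (fun i => (Submodule.mem_iInf _).1 x.2 i) j
  let Bk' : ∀ o : Option ι, Matrix (Fin (o.elim n d)) (Fin (o.elim n d)) ℂ
    | none => Matrix.of fun i j => B (e i) (e j)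
    | some i => Bk i
  let c' := c.reindex (sigmaOptionElimEquiv n d)
  have hn (p : Fin n) : c' ⟨none, p⟩ = e p := (c.reindex_apply _ _).trans (hc p)
  have hs (i : ι) (p : Fin (d i)) : c' ⟨some i, p⟩ = b ⟨i, p⟩ :=
    (c.reindex_apply _ _).trans (hc' ⟨i, p⟩)
  refine ⟨Option ι, inferInstance, fun o => o.elim n d, Bk', c', ?_, ?_, ?_⟩
  · rintro (_ | i) p q
    · exact congrArg₂ (fun x y => B x y) (hn p) (hn q)
    · exact (congrArg₂ (fun x y => B x y) (hs i p) (hs i q)).trans (hb i p q)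
  · rintro (_ | i) (_ | j) p q hij
    · exact absurd rfl hij
    · exact (congrArg₂ (fun x y => B x y) (hn p) (hs j q)).trans (horth' _ _).1
    · exact (congrArg₂ (fun x y => B x y) (hs i p) (hn q)).trans (horth' _ _).2
    · exact (congrArg₂ (fun x y => B x y) (hs i p) (hs j q)).trans
        (hb' i j p q fun h => hij (congrArg some h))
  · rintro (_ | i)
    · exact hblk
    · exact hBk i

end Gluing

section NilpotentChain

/-- A functional vanishing on the kernel of `f : V → U*` is of the form `x ↦ f x u`. -/
theorem exists_forall_eq_apply_of_ker {U V : Type*} [AddCommGroup V] [Module ℂ V]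
    [AddCommGroup U] [Module ℂ U] [FiniteDimensional ℂ U] (f : V →ₗ[ℂ] Module.Dual ℂ U)
    (φ : Module.Dual ℂ V) (h : ∀ x, f x = 0 → φ x = 0) : ∃ u, ∀ x, φ x = f x u := by
  have : φ ∈ LinearMap.range f.dualMap := by
    rw [LinearMap.range_dualMap_eq_dualAnnihilator_ker, Submodule.mem_dualAnnihilator]
    exact fun x hx => h x (LinearMap.mem_ker.1 hx)
  obtain ⟨g, rfl⟩ := this
  refine ⟨(Module.evalEquiv ℂ U).symm g, fun x => ?_⟩
  rw [Module.apply_evalEquiv_symm_apply, LinearMap.dualMap_apply]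

/-- A functional vanishing on the left orthogonal of `L` is represented by an element of `L`. -/
theorem exists_mem_forall_eq_apply {V : Type*} [AddCommGroup V] [Module ℂ V]
    [FiniteDimensional ℂ V] (B : V →ₗ[ℂ] V →ₗ[ℂ] ℂ) (L : Submodule ℂ V) (φ : Module.Dual ℂ V)
    (h : ∀ x, (∀ l ∈ L, B x l = 0) → φ x = 0) : ∃ l ∈ L, ∀ x, φ x = B x l := by
  obtain ⟨u, hu⟩ := exists_forall_eq_apply_of_ker (L.dualRestrict ∘ₗ B) φ fun x hx =>
    h x fun l hl => by simpa using LinearMap.congr_fun hx ⟨l, hl⟩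
  exact ⟨u, u.2, hu⟩

/-- The vectors `e 0, …, e n` have Gram matrix `J_{n+1}(0)`, together with relations on the whole
space guaranteeing that their span can be split off. -/
structure IsNilpotentChain {V : Type*} [AddCommGroup V] [Module ℂ V]
    (B : V →ₗ[ℂ] V →ₗ[ℂ] ℂ) (n : ℕ) (e : ℕ → V) : Prop where
  ne_zero : e 0 ≠ 0
  gram : ∀ i j, i ≤ n → j ≤ n → B (e i) (e j) = if i + 1 = j then 1 else 0
  apply_zero : ∀ v, B v (e 0) = 0
  last_apply : ∀ v, B (e n) v = 0
  rel : ∀ i, i + 2 ≤ n → ∀ v, B (e i) v = B v (e (i + 2))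

/-- A chain in a complement `X` of the left radical `L` inside the left orthogonal of `L` extends
by two vectors to a chain in the whole space. -/
theorem IsNilpotentChain.extend {V : Type*} [AddCommGroup V] [Module ℂ V]
    [FiniteDimensional ℂ V] {B : V →ₗ[ℂ] V →ₗ[ℂ] ℂ} {X : Submodule ℂ V}
    (hXL : ∀ x ∈ X, ∀ l, B l = 0 → B x l = 0) (hdisj : ∀ x ∈ X, B x = 0 → x = 0)
    (hX : ∀ v, (∀ l, B l = 0 → B v l = 0) → ∃ l x, B l = 0 ∧ x ∈ X ∧ v = l + x)
    {n : ℕ} {e : ℕ → X} (he : IsNilpotentChain (B.domRestrict₁₂ X X) n e) :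
    ∃ e' : ℕ → V, IsNilpotentChain B (n + 2) e' := by
  have gram : ∀ i j, i ≤ n → j ≤ n → B (e i) (e j) = if i + 1 = j then 1 else 0 := he.gram
  have hexists (φ : Module.Dual ℂ V) (h : ∀ l x, B l = 0 → x ∈ X → φ (l + x) = 0) :
      ∃ l, B l = 0 ∧ ∀ x, φ x = B x l := by
    obtain ⟨l, hl, hl'⟩ := exists_mem_forall_eq_apply B (LinearMap.ker B) φ fun x hx => by
      obtain ⟨l, x, hl, hxX, rfl⟩ := hX x fun l hl => hx l (LinearMap.mem_ker.2 hl)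
      exact h l x hl hxX
    exact ⟨l, LinearMap.mem_ker.1 hl, hl'⟩
  have heL (i l) (hl : B l = 0) : B (e i) l = 0 := hXL _ (e i).2 l hl
  obtain ⟨lz, hlz, hlz'⟩ := hexists (B (e n)) fun l x hl hx => by
    rw [map_add, heL _ _ hl, zero_add]
    exact he.last_apply ⟨x, hx⟩
  obtain ⟨m, hm1, hm2, hm3⟩ : ∃ m, B (e n) m = 1 ∧
      (∀ k, k + 1 = n → ∀ v, B (e k) v = B v m) ∧ (n = 0 → B m m = 0) := by
    rcases n with _ | n
    · obtain ⟨m, hm⟩ : ∃ m, B (e 0) m ≠ 0 := by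
        by_contra! h
        exact he.ne_zero (Subtype.ext (hdisj _ (e 0).2 (LinearMap.ext h)))
      obtain ⟨m, hm⟩ : ∃ m, B (e 0) m = 1 := ⟨(B (e 0) m)⁻¹ • m, by simp [hm]⟩
      refine ⟨m - B m m • lz, ?_, by simp, fun _ => ?_⟩
      · simp [hm, heL _ _ hlz]
      · have : B m lz = 1 := by rw [← hlz', hm]
        simp [this, hlz]
    · obtain ⟨m, hm⟩ := exists_forall_eq_apply_of_ker B (B (e n)) fun x hx => heL _ _ hx
      refine ⟨m, ?_, fun k hk => ?_, by simp⟩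
      · rw [← hm, gram _ _ (by omega) (by omega), if_pos rfl]
      · obtain rfl : k = n := by omega
        exact hm
  have hmlz : B m lz = 1 := by rw [← hlz', hm1]
  have hem (i) (hi : i ≤ n) : B (e i) m = if i = n then 1 else 0 := by
    split_ifs with h
    · rw [h, hm1]
    · obtain ⟨k, rfl⟩ : ∃ k, n = k + 1 := ⟨n - 1, by omega⟩
      rw [← hm2 k rfl, gram _ _ (by omega) (by omega), if_neg (Ne.symm h)]
  have hc (i) : ∃ c, B c = 0 ∧ (i = 0 → ∀ v, B v (e i + c) = 0) ∧
      (i = 1 → B m (e i + c) = 0) ∧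
      (∀ k, i = k + 2 → i ≤ n → ∀ v, B (e k) v = B v (e i + c)) := by
    rcases i with _ | _ | i
    · obtain ⟨l, hl, hl'⟩ := hexists (B.flip (e 0)) fun l x hl hx => by
        rw [map_add, LinearMap.flip_apply, hl, LinearMap.zero_apply, zero_add]
        exact he.apply_zero ⟨x, hx⟩
      refine ⟨-l, by simp [hl], fun _ v => ?_, by simp, by simp⟩
      have := hl' v
      simp only [LinearMap.flip_apply] at this
      simp [this]
    · refine ⟨-(B m (e 1)) • lz, by simp [hlz], by simp, fun _ => by simp [hmlz], by simp⟩
    · by_cases hi : i + 2 ≤ n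
      · obtain ⟨l, hl, hl'⟩ := hexists (B (e i) - B.flip (e (i + 2))) fun l x hl hx => by
          have h1 : B (e i) x = B x (e (i + 2)) := he.rel i hi ⟨x, hx⟩
          simp [heL _ _ hl, hl, h1]
        refine ⟨l, hl, by simp, by simp, fun k hk _ v => ?_⟩
        obtain rfl : i = k := by omega
        have := hl' v
        simp only [LinearMap.sub_apply, LinearMap.flip_apply] at this
        rw [map_add, ← this]
        ring
      · exact ⟨0, by simp, by simp, by simp, fun k _ h => absurd h hi⟩
  choose c hcL hc0 hc1 hc2 using hc
  have hBc (i) : B (e i + c i) = B (e i) := by rw [map_add, hcL, add_zero]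
  refine ⟨fun i => if i ≤ n then e i + c i else if i = n + 1 then m else lz, ?_, ?_, ?_, ?_, ?_⟩
  · rw [if_pos (Nat.zero_le _)]
    intro h
    apply he.ne_zero
    apply Subtype.ext
    apply hdisj _ (e 0).2
    rw [← hBc, h, map_zero]
  · intro i j hi hj
    have hi' : i ≤ n ∨ i = n + 1 ∨ i = n + 2 := by omega
    have hj' : j ≤ n ∨ j = n + 1 ∨ j = n + 2 := by omega
    rcases hi' with hi' | rfl | rfl
    · rw [if_pos hi', hBc]
      rcases hj' with hj' | rfl | rfl
      · rw [if_pos hj', map_add, heL _ _ (hcL j), add_zero, gram _ _ hi' hj']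
      · simpa using hem i hi'
      · simp [heL _ _ hlz]; omega
    · rcases hj' with hj' | rfl | rfl
      · have : ¬ n + 1 + 1 = j := by omega
        simp only [hj', if_true, this, if_false, Nat.not_succ_le_self]
        rcases j with _ | _ | j
        · exact hc0 0 rfl m
        · exact hc1 1 rfl
        · rw [← hc2 (j + 2) j rfl hj', hem j (by omega), if_neg (by omega)]
      · simp
        rcases n with _ | n
        · exact hm3 rfl
        · rw [← hm2 n rfl, hem n (by omega), if_neg (by omega)]
      · simpa using hmlz
    · have : ¬ n + 2 + 1 = j := by omega
      simp [hlz, this]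
  · intro v
    simpa using hc0 0 rfl v
  · intro v
    simp [hlz]
  · intro i hi v
    have hi' : i + 2 ≤ n ∨ i + 1 = n ∨ i = n := by omega
    rw [if_pos (by omega), hBc]
    rcases hi' with hi' | hi' | rfl
    · rw [if_pos hi']
      exact hc2 (i + 2) i rfl hi' v
    · rw [if_neg (by omega), if_pos (by omega)]
      exact hm2 i hi' v
    · rw [if_neg (by omega), if_neg (by omega)]
      exact hlz' v

/-- A degenerate bilinear form has a nilpotent chain. -/
theorem exists_isNilpotentChain (k : ℕ) : ∀ (V : Type u) [AddCommGroup V] [Module ℂ V]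
    [FiniteDimensional ℂ V] (B : V →ₗ[ℂ] V →ₗ[ℂ] ℂ), Module.finrank ℂ V = k →
    (∃ y, y ≠ 0 ∧ ∀ x, B x y = 0) → ∃ n e, IsNilpotentChain B n e := by
  induction k using Nat.strong_induction_on with
  | _ k ih =>
  rintro V _ _ _ B rfl ⟨y, hy0, hy⟩
  by_cases h1 : ∃ z, z ≠ 0 ∧ B z = 0 ∧ ∀ x, B x z = 0
  · obtain ⟨z, hz, hz', hz''⟩ := h1
    exact ⟨0, fun _ => z, hz, fun i j hi hj => by simp [hz'', show ¬ i + 1 = j by omega], hz'',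
      by simp [hz'], fun i hi => by omega⟩
  by_cases h2 : ∃ r l, (∀ x, B x r = 0) ∧ B l = 0 ∧ B r l ≠ 0
  · obtain ⟨r, l, hr, hl, hrl⟩ := h2
    refine ⟨1, fun i => if i = 0 then r else (B r l)⁻¹ • l, ?_, ?_, ?_, ?_, ?_⟩
    · rintro h
      simp only [if_true] at h
      simp [h] at hrl
    · intro i j hi hj
      interval_cases i <;> interval_cases j <;> simp [hr, hl, hrl]
    · simpa using hr
    · simp [hl]
    · intro i hi
      omega
  push Not at h1 h2
  obtain ⟨X', hX'⟩ := Submodule.exists_isCompl (LinearMap.ker B)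
  let V₁ : Submodule ℂ V := ⨅ l : LinearMap.ker B, LinearMap.ker (B.flip l)
  have hV₁ (v) : v ∈ V₁ ↔ ∀ l, B l = 0 → B v l = 0 := by
    simp [V₁, Submodule.mem_iInf]
  have hXL : ∀ x ∈ X' ⊓ V₁, ∀ l, B l = 0 → B x l = 0 := fun x hx => (hV₁ x).1 hx.2
  have hdisj : ∀ x ∈ X' ⊓ V₁, B x = 0 → x = 0 := fun x hx h =>
    Submodule.disjoint_def.1 hX'.disjoint x (LinearMap.mem_ker.2 h) hx.1
  have hX : ∀ v, (∀ l, B l = 0 → B v l = 0) → ∃ l x, B l = 0 ∧ x ∈ X' ⊓ V₁ ∧ v = l + x := by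
    intro v hv
    obtain ⟨l, hl, x, hx, rfl⟩ := Submodule.mem_sup.1
      (hX'.sup_eq_top ▸ Submodule.mem_top : v ∈ LinearMap.ker B ⊔ X')
    rw [LinearMap.mem_ker] at hl
    refine ⟨l, x, hl, ⟨hx, (hV₁ x).2 fun l' hl' => ?_⟩, rfl⟩
    simpa [hl] using hv l' hl'
  have hlt : Module.finrank ℂ (X' ⊓ V₁ : Submodule ℂ V) < Module.finrank ℂ V := by
    apply Submodule.finrank_lt
    intro htop
    have hinj : Function.Injective B := by
      rw [← LinearMap.ker_eq_bot, LinearMap.ker_eq_bot']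
      exact fun x hx => hdisj x (htop ▸ Submodule.mem_top) hx
    have hsurj := (LinearMap.injective_iff_surjective_of_finrank_eq_finrank
      (Subspace.dual_finrank_eq (K := ℂ) (V := V)).symm).1 hinj
    refine hy0 ((Module.forall_dual_apply_eq_zero_iff ℂ y).1 fun φ => ?_)
    obtain ⟨x, rfl⟩ := hsurj φ
    exact hy x
  obtain ⟨l, x, hl, hx, rfl⟩ := hX y fun l hl => h2 y l hy hl
  have hx0 : (⟨x, hx⟩ : (X' ⊓ V₁ : Submodule ℂ V)) ≠ 0 := by
    intro h
    obtain rfl : x = 0 := congrArg Subtype.val h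
    rw [add_zero] at hy0 hy
    obtain ⟨z, hz⟩ := h1 l hy0 hl
    exact hz (hy z)
  obtain ⟨n, e, he⟩ := ih _ hlt (X' ⊓ V₁ : Submodule ℂ V) (B.domRestrict₁₂ _ _) rfl
    ⟨⟨x, hx⟩, hx0, fun z => by
      have h3 := hy z
      rw [map_add, hXL z z.2 l hl, zero_add] at h3
      exact h3⟩
  obtain ⟨e', he'⟩ := he.extend hXL hdisj hX
  exact ⟨_, e', he'⟩

/-- A nilpotent chain can be split off as a block `J_n(0)`. -/
theorem IsNilpotentChain.hasCanonicalBasis {V : Type u} [AddCommGroup V] [Module ℂ V]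
    {B : V →ₗ[ℂ] V →ₗ[ℂ] ℂ} {n : ℕ} {e : ℕ → V} (he : IsNilpotentChain B n e)
    (hW : ∀ W : Submodule ℂ V, W ≠ ⊤ → HasCanonicalBasis (B.domRestrict₁₂ W W)) :
    HasCanonicalBasis B := by
  obtain ⟨φ, hφ, horth⟩ : ∃ φ : Fin (n + 1) → Module.Dual ℂ V,
      (∀ i j, φ i (e (j : Fin (n + 1))) = if i = j then 1 else 0) ∧
      ∀ v, (∀ i, φ i v = 0) → ∀ j : Fin (n + 1), B (e j) v = 0 ∧ B v (e j) = 0 := by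
    rcases n with _ | n
    · obtain ⟨f, hf⟩ : ∃ f : Module.Dual ℂ V, f (e 0) ≠ 0 := by
        by_contra! h
        exact he.ne_zero ((Module.forall_dual_apply_eq_zero_iff ℂ _).1 h)
      refine ⟨fun _ => (f (e 0))⁻¹ • f, fun i j => ?_, fun v _ j => ?_⟩
      · obtain rfl : i = 0 := by omega
        obtain rfl : j = 0 := by omega
        simp [hf]
      · simp [he.apply_zero, he.last_apply]
    · refine ⟨Fin.cases (B.flip (e 1)) fun i => B (e i), fun i j => ?_, fun v hv j => ⟨?_, ?_⟩⟩
      · induction i using Fin.cases with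
        | zero =>
          have h1 := he.gram j 1 (by omega) (by omega)
          have h2 : ((j : ℕ) + 1 = 1) = ((0 : Fin (n + 2)) = j) := by
            rw [Fin.ext_iff, Fin.val_zero]
            exact propext (by omega)
          simp only [h2] at h1
          exact h1
        | succ i =>
          have h1 := he.gram i j (by omega) (by omega)
          simpa [Fin.ext_iff] using h1
      · refine Fin.lastCases ?_ (fun j => ?_) j
        · exact he.last_apply v
        · exact hv j.succ
      · obtain ⟨_ | _ | j, hj⟩ := j
        · exact he.apply_zero v
        · exact hv 0
        · rw [← he.rel j (by omega)]
          exact hv (Fin.succ ⟨j, by omega⟩)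
  refine .of_split (fun i : Fin (n + 1) => e i) φ hφ horth (Or.inl ?_) (hW _ fun h => ?_)
  · ext i j
    simp [Jb, he.gram i j (by omega) (by omega)]
  · have h0 : e (0 : Fin (n + 1)) ∈ ⨅ i, LinearMap.ker (φ i) := h ▸ Submodule.mem_top
    have := (Submodule.mem_iInf _).1 h0 0
    rw [LinearMap.mem_ker, hφ] at this
    simp at this

end NilpotentChain

section CanonicalMatrices

/-- A matrix which becomes triangular with nonzero diagonal after a permutation of its rows, with
respect to the preorder given by `ℓ`, is invertible. -/
theorem isUnit_of_triangular {κ : Type*} [Fintype κ] [DecidableEq κ] {M : Matrix κ κ ℂ}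
    (σ : κ → κ) (ℓ : κ → ℕ) (h0 : ∀ i j, i ≠ j → ℓ i ≤ ℓ j → M (σ i) j = 0)
    (h1 : ∀ i, M (σ i) i ≠ 0) : IsUnit M := by
  rw [← Matrix.mulVec_injective_iff_isUnit]
  change Function.Injective M.mulVecLin
  rw [← LinearMap.ker_eq_bot, LinearMap.ker_eq_bot']
  intro v hv
  have key (k : ℕ) : ∀ i, ℓ i = k → v i = 0 := by
    induction k using Nat.strong_induction_on with
    | _ k ih =>
    rintro i rfl
    have h2 : ∑ j, M (σ i) j * v j = 0 := congrFun hv (σ i)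
    rw [Finset.sum_eq_single i] at h2
    · exact (mul_eq_zero.1 h2).resolve_left (h1 i)
    · intro j _ hj
      rcases lt_or_ge (ℓ j) (ℓ i) with h | h
      · rw [ih _ h j rfl, mul_zero]
      · rw [h0 i j hj.symm h, zero_mul]
    · simp
  exact funext fun i => key _ i rfl

theorem isUnit_Jb (n : ℕ) {a : ℂ} (ha : a ≠ 0) : IsUnit (Jb n a) := by
  refine isUnit_of_triangular id (fun i => n - 1 - i) (fun i j hij h => ?_) fun i => ?_
  · simp only [Jb, id, Matrix.of_apply, hij, if_false]
    rw [if_neg (by omega)]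
  · simp [Jb, ha]

theorem isUnit_Gam (n : ℕ) : IsUnit (Gam n) := by
  refine isUnit_of_triangular Fin.rev (fun i => n - 1 - i) (fun i j hij h => ?_) fun i => ?_
  · simp only [Gam, Matrix.of_apply, Fin.val_rev]
    rw [if_neg (by omega)]
  · simp only [Gam, Matrix.of_apply, Fin.val_rev]
    rw [if_pos (by omega)]
    simp

theorem isUnit_fromBlocks_Jb (n : ℕ) {a : ℂ} (ha : a ≠ 0) :
    IsUnit (Matrix.fromBlocks 0 1 (Jb n a) 0 : Matrix (Fin n ⊕ Fin n) (Fin n ⊕ Fin n) ℂ) := by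
  refine IsUnit.of_mul_eq_one (Matrix.fromBlocks 0 (Jb n a)⁻¹ 1 0) ?_
  rw [Matrix.fromBlocks_multiply]
  simp [Matrix.mul_nonsing_inv _ ((Matrix.isUnit_iff_isUnit_det _).1 (isUnit_Jb n ha))]

theorem sum_Jb_smul {V : Type*} [AddCommGroup V] [Module ℂ V] {n : ℕ} (a : ℂ) (v : Fin n → V)
    (j : Fin n) : ∑ k, Jb n a k j • v k =
      a • v j + if h : 0 < (j : ℕ) then v ⟨j - 1, by omega⟩ else 0 := by
  have h1 (k) : Jb n a k j • v k =
      (if k = j then a • v j else 0) + if (k : ℕ) + 1 = j then v k else 0 := by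
    by_cases h : k = j
    · subst h
      simp [Jb]
    · simp [Jb, h]
  rw [Finset.sum_congr rfl fun k _ => h1 k, Finset.sum_add_distrib]
  congr 1
  · simp
  · split_ifs with h
    · rw [Finset.sum_eq_single ⟨j - 1, by omega⟩]
      · rw [if_pos (by simp; omega)]
      · intro k _ hk
        rw [if_neg]
        contrapose! hk
        ext
        simp
        omega
      · simp
    · exact Finset.sum_eq_zero fun k _ => if_neg (by omega)

theorem sum_Jb_smul' {V : Type*} [AddCommGroup V] [Module ℂ V] {n : ℕ} (a : ℂ) (v : Fin n → V)
    (j : Fin n) : ∑ k, Jb n a j k • v k =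
      a • v j + if h : (j : ℕ) + 1 < n then v ⟨j + 1, h⟩ else 0 := by
  have h1 (k) : Jb n a j k • v k =
      (if k = j then a • v j else 0) + if (j : ℕ) + 1 = k then v k else 0 := by
    by_cases h : k = j
    · subst h
      simp [Jb]
    · simp [Jb, h, Ne.symm h]
  rw [Finset.sum_congr rfl fun k _ => h1 k, Finset.sum_add_distrib]
  congr 1
  · simp
  · split_ifs with h
    · rw [Finset.sum_eq_single ⟨j + 1, h⟩]
      · simp
      · intro k _ hk
        rw [if_neg]
        contrapose! hk
        ext
        simp
        omega
      · simp
    · exact Finset.sum_eq_zero fun k _ => if_neg (by omega)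

theorem mul_Jb_apply {n : ℕ} (M : Matrix (Fin n) (Fin n) ℂ) (a : ℂ) (i j : Fin n) :
    (M * Jb n a) i j = a * M i j + if h : 0 < (j : ℕ) then M i ⟨j - 1, by omega⟩ else 0 := by
  have := sum_Jb_smul a (fun k => M i k) j
  simp only [smul_eq_mul] at this
  rw [← this, Matrix.mul_apply]
  exact Finset.sum_congr rfl fun k _ => mul_comm _ _

theorem Gam_transpose_mul (n : ℕ) :
    (Gam n)ᵀ * Jb n 1 = Gam n * (-(-1 : ℂ) ^ (n + 1) • Jb n (-1)) := by
  ext i j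
  rw [Matrix.mul_smul, Matrix.smul_apply, mul_Jb_apply, mul_Jb_apply]
  obtain ⟨i, hi⟩ := i
  obtain ⟨j, hj⟩ := j
  simp only [Matrix.transpose_apply, Gam, Matrix.of_apply, smul_eq_mul]
  have key (a b : ℕ) (h : (a + b) % 2 = 0) : (-1 : ℂ) ^ a = (-1) ^ b := by
    rw [neg_one_pow_eq_pow_mod_two, neg_one_pow_eq_pow_mod_two (n := b)]
    congr 1
    omega
  by_cases h1 : i + j + 1 = n
  · have : (-1 : ℂ) ^ (n - 1 - j) = (-1) ^ (n + 1) * (-1) ^ (n - 1 - i) := by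
      rw [← pow_add]
      exact key _ _ (by omega)
    split_ifs <;> first | (exfalso; omega) | (rw [this]; ring)
  by_cases h2 : i + j = n
  · have : (-1 : ℂ) ^ (n - 1 - j) = -(-1) ^ (n - 1 - (j - 1)) := by
      rw [show n - 1 - (j - 1) = (n - 1 - j) + 1 by omega]
      ring
    split_ifs <;> first | (exfalso; omega) | (rw [this]; ring)
  by_cases h3 : i + j = n + 1
  · have : (-1 : ℂ) ^ (n - 1 - (j - 1)) = (-1) ^ (n + 1 + 1) * (-1) ^ (n - 1 - i) := by
      rw [← pow_add]
      exact key _ _ (by omega)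
    split_ifs <;> first | (exfalso; omega) | (rw [this]; ring)
  · split_ifs <;> first | (exfalso; omega) | simp

end CanonicalMatrices

section Recursion

variable {μ : ℂ} {n : ℕ} {g : ℕ → ℕ → ℂ}

theorem eq_zero_of_recursion_of_le (hμ : μ ^ 2 = 1)
    (hrec : ∀ i j, g i j =
      μ ^ 2 * g i j + μ * (g (i + 1) j + g i (j + 1)) + g (i + 1) (j + 1))
    (hl : ∀ i j, n ≤ i → g i j = 0) {i j : ℕ} (hij : n ≤ i + j) : g i j = 0 := by
  have hμ0 : μ ≠ 0 := by
    rintro rfl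
    norm_num at hμ
  rcases le_or_gt n i with h | h
  · exact hl i j h
  obtain ⟨j, rfl⟩ : ∃ k, j = k + 1 := ⟨j - 1, by omega⟩
  have h1 := eq_zero_of_recursion_of_le hμ hrec hl (i := i + 1) (j := j) (by omega)
  have h2 := eq_zero_of_recursion_of_le hμ hrec hl (i := i + 1) (j := j + 1) (by omega)
  have h3 := hrec i j
  rw [h1, h2, hμ] at h3
  have : μ * g i (j + 1) = 0 := by linear_combination -h3
  exact (mul_eq_zero.1 this).resolve_left hμ0
termination_by n - i

theorem eq_pow_mul_of_recursion (hμ : μ ^ 2 = 1)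
    (hrec : ∀ i j, g i j =
      μ ^ 2 * g i j + μ * (g (i + 1) j + g i (j + 1)) + g (i + 1) (j + 1))
    (hl : ∀ i j, n ≤ i → g i j = 0) {i j : ℕ} (hij : i + j + 1 = n) :
    g i j = (-1) ^ j * g (n - 1) 0 := by
  have hμ0 : μ ≠ 0 := by
    rintro rfl
    norm_num at hμ
  induction j generalizing i with
  | zero => simp [← hij]
  | succ j ih =>
    have h1 := ih (i := i + 1) (by omega)
    have h2 := eq_zero_of_recursion_of_le hμ hrec hl (i := i + 1) (j := j + 1) (by omega)
    have h3 := hrec i j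
    rw [h2, hμ] at h3
    have : μ * (g (i + 1) j + g i (j + 1)) = 0 := by linear_combination -h3
    have := (mul_eq_zero.1 this).resolve_left hμ0
    rw [pow_succ]
    linear_combination this - h1

theorem eq_zero_of_recursion_of_sq_ne_one (hμ : μ ^ 2 ≠ 1)
    (hrec : ∀ i j, g i j =
      μ ^ 2 * g i j + μ * (g (i + 1) j + g i (j + 1)) + g (i + 1) (j + 1))
    (hl : ∀ i j, n ≤ i → g i j = 0) (hr : ∀ i j, n ≤ j → g i j = 0) (i j : ℕ) : g i j = 0 := by
  rcases le_or_gt n i with h | h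
  · exact hl i j h
  rcases le_or_gt n j with h' | h'
  · exact hr i j h'
  have h1 := eq_zero_of_recursion_of_sq_ne_one hμ hrec hl hr (i + 1) j
  have h2 := eq_zero_of_recursion_of_sq_ne_one hμ hrec hl hr i (j + 1)
  have h3 := eq_zero_of_recursion_of_sq_ne_one hμ hrec hl hr (i + 1) (j + 1)
  have h4 := hrec i j
  rw [h1, h2, h3] at h4
  have : (μ ^ 2 - 1) * g i j = 0 := by linear_combination -h4
  exact (mul_eq_zero.1 this).resolve_left (sub_ne_zero.2 hμ)
termination_by (n - i) + (n - j)

theorem eq_zero_of_recursion (hμ : μ ≠ (-1) ^ (n + 1))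
    (hrec : ∀ i j, g i j =
      μ ^ 2 * g i j + μ * (g (i + 1) j + g i (j + 1)) + g (i + 1) (j + 1))
    (hl : ∀ i j, n ≤ i → g i j = 0) (hr : ∀ i j, n ≤ j → g i j = 0)
    (hsymm : ∀ i j, ∃ i' j', i' + j' = i + j + 1 ∧ g i j = μ * g j i + g i' j')
    {i j : ℕ} (hij : n ≤ i + j + 1) : g i j = 0 := by
  by_cases hμ1 : μ ^ 2 = 1
  · rcases hij.eq_or_lt with h | h
    · obtain ⟨n, rfl⟩ : ∃ k, n = k + 1 := ⟨n - 1, by omega⟩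
      rw [eq_pow_mul_of_recursion hμ1 hrec hl h.symm]
      have h1 := eq_pow_mul_of_recursion hμ1 hrec hl (i := 0) (j := n) (by omega)
      obtain ⟨i', j', h2, h3⟩ := hsymm n 0
      rw [eq_zero_of_recursion_of_le hμ1 hrec hl (i := i') (by omega), h1] at h3
      have h4 : μ * (-1) ^ n = -1 := by
        have : (μ * (-1) ^ n) ^ 2 = 1 := by
          rw [mul_pow, hμ1, ← pow_mul, mul_comm n, pow_mul]
          simp
        rcases mul_self_eq_one_iff.1 ((sq _).symm.trans this) with h | h
        · exfalso
          apply hμ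
          have h5 : ((-1 : ℂ) ^ n) * (-1) ^ n = 1 := by
            rw [← mul_pow]
            simp
          rw [pow_add, pow_add]
          linear_combination (-1 : ℂ) ^ n * h - μ * h5
        · exact h
      have h5 : g n 0 = 0 := by
        simp only [Nat.add_sub_cancel] at h3
        linear_combination h3 / 2 + g n 0 / 2 * h4
      simp [h5]
    · exact eq_zero_of_recursion_of_le hμ1 hrec hl (by omega)
  · exact eq_zero_of_recursion_of_sq_ne_one hμ1 hrec hl hr i j

end Recursion

section Nondegenerate

variable {V : Type*} [AddCommGroup V] [Module ℂ V] {B : V →ₗ[ℂ] V →ₗ[ℂ] ℂ}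

/-- A family spanning a subspace invariant under the asymmetry `T` of `B`, whose Gram matrix has
the same cosquare as a canonical block, can be split off. -/
theorem HasCanonicalBasis.of_cosquare {T : V →ₗ[ℂ] V} (hT : ∀ x y, B x y = B y (T x)) {n : ℕ}
    (hn : 0 < n) {κ : Type*} [Fintype κ] [DecidableEq κ] (ρ : κ ≃ Fin n) (e : κ → V)
    {X Y H : Matrix κ κ ℂ} (hY : IsUnit Y) (hH : IsUnit H) (hHX : Hᵀ * X = H * Y)
    (hblk : IsCanonicalBlock (Matrix.reindex ρ ρ H))
    (hG : IsUnit (Matrix.of fun i j => B (e i) (e j)))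
    (hrel : ∀ j, T (∑ k, X k j • e k) = ∑ k, Y k j • e k)
    (hW : ∀ W : Submodule ℂ V, W ≠ ⊤ → HasCanonicalBasis (B.domRestrict₁₂ W W)) :
    HasCanonicalBasis B := by
  set G : Matrix κ κ ℂ := Matrix.of fun i j => B (e i) (e j) with hGdef
  have hGX : Gᵀ * X = G * Y := by
    ext i j
    have h1 := hT (∑ k, X k j • e k) (e i)
    rw [hrel] at h1
    simpa [Matrix.mul_apply, hGdef, mul_comm] using h1
  obtain ⟨S, hS, hSG⟩ := exists_congruent_of_cosquare_eq hG hH hY hGX hHX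
  let f : κ → V := fun j => ∑ i, S i j • e i
  have hf (i j) : B (f i) (f j) = H i j := by
    rw [← hSG]
    simp only [f, map_sum, map_smul, LinearMap.sum_apply, LinearMap.smul_apply, smul_eq_mul,
      Matrix.mul_apply, hGdef, Matrix.transpose_apply, Matrix.of_apply, Finset.mul_sum,
      Finset.sum_mul]
    exact Finset.sum_congr rfl fun _ _ => Finset.sum_congr rfl fun _ _ => by ring
  have hinj {M : Matrix κ κ ℂ} (hM : IsUnit M) {v : κ → ℂ} (h : ∀ i, ∑ k, M i k * v k = 0) (k) :
      v k = 0 := by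
    have h1 : M *ᵥ v = M *ᵥ 0 := by
      rw [Matrix.mulVec_zero]
      exact funext h
    exact congrFun (Matrix.mulVec_injective_iff_isUnit.2 hM h1) k
  have hHdet := (Matrix.isUnit_iff_isUnit_det H).1 hH
  let φ : κ → Module.Dual ℂ V := fun i => ∑ k, H⁻¹ i k • B (f k)
  have hφ (i j) : φ i (f j) = if i = j then 1 else 0 := by
    have h1 : φ i (f j) = (H⁻¹ * H) i j := by
      simp [φ, hf, Matrix.mul_apply]
    rw [h1, Matrix.nonsing_inv_mul _ hHdet, Matrix.one_apply]
  have horth (v) (hv : ∀ i, φ i v = 0) (j) : B (f j) v = 0 ∧ B v (f j) = 0 := by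
    have h1 (k) : B (f k) v = 0 := by
      refine hinj (M := H⁻¹) (v := fun k => B (f k) v) ?_ (fun i => ?_) k
      · exact IsUnit.of_mul_eq_one H (Matrix.nonsing_inv_mul _ hHdet)
      · simpa [φ] using hv i
    have h2 (k) : B (e k) v = 0 := by
      refine hinj (M := Sᵀ) (v := fun k => B (e k) v) ?_ (fun i => ?_) k
      · exact (Matrix.isUnit_transpose S).2 hS
      · simpa [f] using h1 i
    have h3 (k) : B v (e k) = 0 := by
      refine hinj (M := Yᵀ) (v := fun k => B v (e k)) ?_ (fun i => ?_) k
      · exact (Matrix.isUnit_transpose Y).2 hY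
      · have h4 := hT (∑ k, X k i • e k) v
        rw [hrel] at h4
        simpa [h2] using h4.symm
    exact ⟨h1 j, by simp [f, h3]⟩
  refine .of_split (fun i => f (ρ.symm i)) (fun i => φ (ρ.symm i)) (fun i j => ?_)
    (fun v hv j => ?_) ?_ (hW _ fun h => ?_)
  · simp [hφ]
  · exact horth v (fun i => by simpa using hv (ρ i)) _
  · convert hblk using 1
    ext i j
    simp [hf]
  · have h0 : f (ρ.symm ⟨0, hn⟩) ∈ ⨅ i, LinearMap.ker (φ (ρ.symm i)) := h ▸ Submodule.mem_top
    have := (Submodule.mem_iInf _).1 h0 ⟨0, hn⟩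
    rw [LinearMap.mem_ker, hφ] at this
    simp at this

theorem apply_pow_apply_pow_recursion {D : Module.End ℂ V} {μ : ℂ}
    (hD : ∀ a b, B (μ • a + D a) (μ • b + D b) = B a b) (x y : V) (i j : ℕ) :
    B ((D ^ i) x) ((D ^ j) y) = μ ^ 2 * B ((D ^ i) x) ((D ^ j) y) +
      μ * (B ((D ^ (i + 1)) x) ((D ^ j) y) + B ((D ^ i) x) ((D ^ (j + 1)) y)) +
        B ((D ^ (i + 1)) x) ((D ^ (j + 1)) y) := by
  conv_lhs => rw [← hD]
  simp only [pow_succ' D, Module.End.mul_apply, map_add, map_smul, LinearMap.add_apply,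
    LinearMap.smul_apply, smul_eq_mul]
  ring

theorem pow_apply_eq_zero_of_le {D : Module.End ℂ V} {n m : ℕ} {x : V} (hx : (D ^ n) x = 0)
    (h : n ≤ m) : (D ^ m) x = 0 := by
  rw [← Nat.sub_add_cancel h, pow_add, Module.End.mul_apply, hx, map_zero]

variable {T E F : Module.End ℂ V} {μ : ℂ} {n : ℕ}

theorem apply_add_apply_add (hT : ∀ x y, B x y = B y (T x)) (hTE : ∀ x, T (μ • x + E x) = x)
    (a b : V) : B (μ • a + E a) (μ • b + E b) = B a b := by
  rw [hT, hTE, hT, hTE]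

theorem pow_apply_apply (hT : ∀ x y, B x y = B y (T x)) (hTE : ∀ x, T (μ • x + E x) = x)
    (hTF : ∀ x, T x = μ • x + F x) (i : ℕ) (a b : V) :
    B ((E ^ i) a) b = B a ((F ^ i) b) := by
  induction i generalizing a b with
  | zero => simp
  | succ i ih =>
    have h1 : B (E a) ((F ^ i) b) = B a (F ((F ^ i) b)) := by
      have h2 := hT (μ • a + E a) ((F ^ i) b)
      rw [hTE, hT _ a, hTF] at h2
      simpa using h2
    rw [pow_succ, Module.End.mul_apply, ih, h1, pow_succ', Module.End.mul_apply]

/-- Two dual Jordan chains of the asymmetry give a block `[[0, I_n], [J_n(μ), 0]]`. -/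
theorem hasCanonicalBasis_of_dual_chains (hT : ∀ x y, B x y = B y (T x))
    (hTE : ∀ x, T (μ • x + E x) = x) (hTF : ∀ x, T x = μ • x + F x) (hn : 0 < n) (hμ0 : μ ≠ 0)
    (hμ : μ ≠ (-1) ^ (n + 1)) {x y : V} (hx : (E ^ n) x = 0) (hy : (F ^ n) y = 0)
    (hxy : B ((E ^ (n - 1)) x) y = 1)
    (hW : ∀ W : Submodule ℂ V, W ≠ ⊤ → HasCanonicalBasis (B.domRestrict₁₂ W W)) :
    HasCanonicalBasis B := by
  have hadj' (i j) : B ((E ^ i) x) ((F ^ j) y) = B ((E ^ (i + j)) x) y := by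
    rw [← pow_apply_apply hT hTE hTF, ← Module.End.mul_apply, ← pow_add, add_comm]
  have hxx {i j} (hij : n ≤ i + j + 1) : B ((E ^ i) x) ((E ^ j) x) = 0 := by
    refine eq_zero_of_recursion (g := fun i j => B ((E ^ i) x) ((E ^ j) x)) hμ
      (apply_pow_apply_pow_recursion (apply_add_apply_add hT hTE) x x)
      (fun i j h => ?_) (fun i j h => ?_) (fun i j => ⟨j + 1, i, by omega, ?_⟩) hij
    · simp [pow_apply_eq_zero_of_le hx h]
    · simp [pow_apply_eq_zero_of_le hx h]
    · have := hT (μ • (E ^ j) x + E ((E ^ j) x)) ((E ^ i) x)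
      rw [hTE] at this
      simpa [pow_succ', Module.End.mul_apply] using this.symm
  have hyy {i j} (hij : n ≤ i + j + 1) : B ((F ^ i) y) ((F ^ j) y) = 0 := by
    refine eq_zero_of_recursion (g := fun i j => B ((F ^ i) y) ((F ^ j) y)) hμ
      (apply_pow_apply_pow_recursion (fun a b => ?_) y y)
      (fun i j h => ?_) (fun i j h => ?_) (fun i j => ⟨j, i + 1, by omega, ?_⟩) hij
    · rw [← hTF, ← hTF, ← hT, ← hT]
    · simp [pow_apply_eq_zero_of_le hy h]
    · simp [pow_apply_eq_zero_of_le hy h]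
    · have := hT ((F ^ i) y) ((F ^ j) y)
      rw [hTF] at this
      simpa [pow_succ', Module.End.mul_apply] using this
  have hyx (i j) : B ((F ^ j) y) ((E ^ i) x) =
      μ * B ((E ^ (i + j)) x) y + B ((E ^ (i + 1 + j)) x) y := by
    have := hT (μ • (E ^ i) x + E ((E ^ i) x)) ((F ^ j) y)
    rw [hTE] at this
    rw [← this, ← hadj', ← hadj']
    simp [pow_succ', Module.End.mul_apply]
  have hzero {m} (hm : n ≤ m) : B ((E ^ m) x) y = 0 := by
    simp [pow_apply_eq_zero_of_le hx hm]
  refine .of_cosquare hT (n := n + n) (by omega) finSumFinEquiv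
    (Sum.elim (fun i : Fin n => (E ^ (n - 1 - i)) x) fun j : Fin n => (F ^ (j : ℕ)) y)
    (X := Matrix.fromBlocks (Jb n μ) 0 0 1) (Y := Matrix.fromBlocks 1 0 0 (Jb n μ)ᵀ)
    (H := Matrix.fromBlocks 0 1 (Jb n μ) 0) ?_ (isUnit_fromBlocks_Jb n hμ0) ?_ ?_ ?_ ?_ hW
  · rw [Matrix.isUnit_iff_isUnit_det, Matrix.det_fromBlocks_zero₁₂, Matrix.det_one, one_mul,
      Matrix.det_transpose, ← Matrix.isUnit_iff_isUnit_det]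
    exact isUnit_Jb n hμ0
  · simp [Matrix.fromBlocks_transpose, Matrix.fromBlocks_multiply]
  · exact Or.inr (Or.inr ⟨n, μ, rfl, hμ0, hμ, by simp [PairBlk]⟩)
  · refine isUnit_of_triangular Sum.swap
      (Sum.elim (fun i => n - 1 - i) fun j => j) ?_ ?_
    · rintro (i | i) (j | j) hij h <;>
        simp only [Sum.elim_inl, Sum.elim_inr, ne_eq, Sum.inl.injEq, Sum.inr.injEq] at hij h <;>
        simp only [Matrix.of_apply, Sum.swap_inl, Sum.swap_inr, Sum.elim_inl, Sum.elim_inr]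
      · rw [hyx, hzero (by omega), hzero (by omega)]
        simp
      · exact hyy (by omega)
      · exact hxx (by omega)
      · rw [hadj', hzero (by omega)]
    · rintro (i | i) <;>
        simp only [Matrix.of_apply, Sum.swap_inl, Sum.swap_inr, Sum.elim_inl, Sum.elim_inr]
      · rw [hyx, hzero (m := _ + 1 + _) (by omega), show n - 1 - (i : ℕ) + i = n - 1 by omega, hxy]
        simpa using hμ0
      · rw [hadj', show n - 1 - (i : ℕ) + i = n - 1 by omega, hxy]
        exact one_ne_zero
  · rintro (j | j)
    · simp only [Fintype.sum_sum_type, Matrix.fromBlocks_apply₁₁, Matrix.fromBlocks_apply₂₁,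
        Sum.elim_inl, Sum.elim_inr, Matrix.zero_apply, zero_smul, Finset.sum_const_zero, add_zero,
        sum_Jb_smul]
      have h1 : (if h : 0 < (j : ℕ) then (E ^ (n - 1 - ((⟨j - 1, by omega⟩ : Fin n) : ℕ))) x
          else 0) = E ((E ^ (n - 1 - j)) x) := by
        rw [← Module.End.mul_apply, ← pow_succ']
        split_ifs with h
        · congr 2
          simp
          omega
        · rw [pow_apply_eq_zero_of_le hx (by omega)]
      rw [h1, hTE]
      simp [Matrix.one_apply]
    · simp only [Fintype.sum_sum_type, Matrix.fromBlocks_apply₁₂, Matrix.fromBlocks_apply₂₂,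
        Sum.elim_inl, Sum.elim_inr, Matrix.zero_apply, zero_smul, Finset.sum_const_zero, zero_add,
        Matrix.transpose_apply, sum_Jb_smul']
      have h1 : (if h : (j : ℕ) + 1 < n then (F ^ ((⟨j + 1, h⟩ : Fin n) : ℕ)) y else 0) =
          F ((F ^ (j : ℕ)) y) := by
        rw [← Module.End.mul_apply, ← pow_succ']
        split_ifs with h
        · rfl
        · rw [pow_apply_eq_zero_of_le hy (by omega)]
      rw [h1, ← hTF]
      simp [Matrix.one_apply]

/-- A self-dual Jordan chain of the asymmetry gives a block `Γ_n`. -/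
theorem hasCanonicalBasis_of_self_dual_chain (hT : ∀ x y, B x y = B y (T x))
    (hTE : ∀ x, T (μ • x + E x) = x) (hn : 0 < n) (hμ : μ = (-1) ^ (n + 1)) {z : V}
    (hz : (E ^ n) z = 0) (hzz : B ((E ^ (n - 1)) z) z ≠ 0)
    (hW : ∀ W : Submodule ℂ V, W ≠ ⊤ → HasCanonicalBasis (B.domRestrict₁₂ W W)) :
    HasCanonicalBasis B := by
  have hμ2 : μ ^ 2 = 1 := by
    rw [hμ, ← pow_mul, mul_comm, pow_mul]
    simp
  have hμ0 : μ ≠ 0 := by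
    rintro rfl
    norm_num at hμ2
  have hrec := apply_pow_apply_pow_recursion (apply_add_apply_add hT hTE)
  let Q : Module.End ℂ V := E + (2 * μ) • 1
  have hQ (v) : Q v = E v + (2 * μ) • v := rfl
  have hEQ : Commute E Q := (Commute.refl E).add_right ((Commute.one_right E).smul_right _)
  have hcomm (i j) (v) : (E ^ i) ((Q ^ j) v) = (Q ^ j) ((E ^ i) v) := by
    rw [← Module.End.mul_apply, (hEQ.pow_pow i j).eq, Module.End.mul_apply]
  have hQz (j) : (E ^ n) ((Q ^ j) z) = 0 := by rw [hcomm, hz, map_zero]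
  have hgram0 {a b c d : ℕ} (h : n ≤ a + c) :
      B ((E ^ a) ((Q ^ b) z)) ((E ^ c) ((Q ^ d) z)) = 0 :=
    eq_zero_of_recursion_of_le (g := fun a c => B ((E ^ a) ((Q ^ b) z)) ((E ^ c) ((Q ^ d) z)))
      hμ2 (hrec _ _) (fun i j h => by simp [pow_apply_eq_zero_of_le (hQz b) h]) h
  have hgram1 {a b c d : ℕ} (h : a + c + 1 = n) :
      B ((E ^ a) ((Q ^ b) z)) ((E ^ c) ((Q ^ d) z)) =
        (-1) ^ c * B ((E ^ (n - 1)) ((Q ^ b) z)) ((Q ^ d) z) :=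
    eq_pow_mul_of_recursion (g := fun a c => B ((E ^ a) ((Q ^ b) z)) ((E ^ c) ((Q ^ d) z)))
      hμ2 (hrec _ _) (fun i j h => by simp [pow_apply_eq_zero_of_le (hQz b) h]) h
  have hl (b) : (E ^ (n - 1)) ((Q ^ b) z) = (2 * μ) ^ b • (E ^ (n - 1)) z := by
    induction b with
    | zero => simp
    | succ b ih =>
      rw [pow_succ' Q, Module.End.mul_apply, hQ, map_add, map_smul, ih, ← Module.End.mul_apply,
        ← pow_succ, Nat.sub_add_cancel hn, hQz, zero_add, smul_smul, pow_succ']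
  have hr (d) : B ((E ^ (n - 1)) z) ((Q ^ d) z) = (2 * μ) ^ d * B ((E ^ (n - 1)) z) z := by
    induction d with
    | zero => simp
    | succ d ih =>
      have h1 := hgram0 (a := n - 1) (b := 0) (c := 1) (d := d) (by omega)
      simp only [pow_zero, Module.End.one_apply, pow_one] at h1
      rw [pow_succ' Q, Module.End.mul_apply, hQ, map_add, map_smul, ih, h1, zero_add, smul_eq_mul,
        pow_succ']
      ring
  refine .of_cosquare hT hn (Equiv.refl _)
    (fun j : Fin n => (E ^ (n - 1 - j)) ((Q ^ (j : ℕ)) z))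
    (X := Jb n 1) (Y := -(-1 : ℂ) ^ (n + 1) • Jb n (-1)) (H := Gam n) ?_ (isUnit_Gam n)
    (Gam_transpose_mul n) (Or.inr (Or.inl (by simp))) ?_ (fun j => ?_) hW
  · rw [Matrix.isUnit_iff_isUnit_det, Matrix.det_smul]
    refine IsUnit.mul ?_ ((Matrix.isUnit_iff_isUnit_det _).1 (isUnit_Jb n (by norm_num)))
    simp
  · refine isUnit_of_triangular Fin.rev (fun i => n - 1 - i) (fun i j hij h => ?_) fun i => ?_
    · simp only [Matrix.of_apply, Fin.val_rev]
      exact hgram0 (by omega)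
    · simp only [Matrix.of_apply, Fin.val_rev]
      rw [hgram1 (by omega), hl, map_smul, LinearMap.smul_apply, hr]
      simp [hμ0, hzz]
  · rw [sum_Jb_smul]
    simp only [Matrix.smul_apply, smul_assoc, ← Finset.smul_sum]
    rw [sum_Jb_smul, ← hμ]
    set w : V := if h : 0 < (j : ℕ) then
      (E ^ (n - 1 - ((⟨j - 1, by omega⟩ : Fin n) : ℕ)))
        ((Q ^ ((⟨j - 1, by omega⟩ : Fin n) : ℕ)) z) else 0 with hw
    set v : V := (E ^ (n - 1 - (j : ℕ))) ((Q ^ (j : ℕ)) z) with hv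
    have hvw : E v = Q w := by
      rw [hv, ← Module.End.mul_apply, ← pow_succ', hw]
      split_ifs with h
      · simp only
        rw [hcomm, hcomm, ← Module.End.mul_apply, ← Module.End.mul_apply, ← Module.End.mul_apply,
          ← pow_succ']
        congr 3 <;> omega
      · rw [map_zero, pow_apply_eq_zero_of_le (hQz _) (by omega)]
    have h1 := hTE (v - w)
    rw [map_sub, hvw, hQ] at h1
    have h2 : μ • (v - w) + (E w + (2 * μ) • w - E w) = μ • (v + w) := by module
    rw [h2, map_smul] at h1
    have h3 : T (v + w) = μ • (v - w) := by
      rw [← h1, smul_smul, ← sq, hμ2, one_smul]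
    rw [one_smul, h3]
    module

/-- A canonical block can be split off from a nondegenerate form. -/
theorem HasCanonicalBasis.of_nondegenerate [FiniteDimensional ℂ V] [Nontrivial V]
    (h : ∀ y, (∀ x, B x y = 0) → y = 0)
    (hW : ∀ W : Submodule ℂ V, W ≠ ⊤ → HasCanonicalBasis (B.domRestrict₁₂ W W)) :
    HasCanonicalBasis B := by
  have hinj : Function.Injective B.flip := by
    rw [← LinearMap.ker_eq_bot, LinearMap.ker_eq_bot']
    exact fun y hy => h y fun x => LinearMap.congr_fun hy x
  have hsurj : Function.Surjective B.flip :=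
    (LinearMap.injective_iff_surjective_of_finrank_eq_finrank
      (Subspace.dual_finrank_eq (K := ℂ) (V := V)).symm).1 hinj
  let L := LinearEquiv.ofBijective B.flip ⟨hinj, hsurj⟩
  let T₀ : Module.End ℂ V := L.symm.toLinearMap ∘ₗ B
  have hT (x y) : B x y = B y (T₀ x) :=
    (LinearMap.congr_fun (L.apply_symm_apply (B x)) y).symm
  have hT₀ : Function.Injective T₀ := by
    rw [← LinearMap.ker_eq_bot, LinearMap.ker_eq_bot']
    refine fun x hx => (Module.forall_dual_apply_eq_zero_iff ℂ x).1 fun φ => ?_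
    obtain ⟨y, rfl⟩ := hsurj φ
    rw [LinearMap.flip_apply, hT, hx, map_zero]
  let T' := LinearEquiv.ofInjectiveEndo T₀ hT₀
  let P : Module.End ℂ V := T'.symm.toLinearMap
  have hTP (x) : T₀ (P x) = x := T'.apply_symm_apply x
  have hPT (x) : P (T₀ x) = x := T'.symm_apply_apply x
  obtain ⟨μ, hμ⟩ := Module.End.exists_eigenvalue P
  obtain ⟨u, hu⟩ := hμ.exists_hasEigenvector
  have hu' := hu.apply_eq_smul
  have hμ0 : μ ≠ 0 := by
    rintro rfl
    apply hu.2
    rw [← hTP u, hu', zero_smul, map_zero]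
  let E : Module.End ℂ V := P - μ • 1
  let F : Module.End ℂ V := T₀ - μ • 1
  have hE (x) : E x = P x - μ • x := rfl
  have hF (x) : F x = T₀ x - μ • x := rfl
  have hTE (x) : T₀ (μ • x + E x) = x := by rw [hE, add_sub_cancel, hTP]
  have hTF (x) : T₀ x = μ • x + F x := by rw [hF, add_sub_cancel]
  have hEu : E u = 0 := by rw [hE, hu', sub_self]
  have hex : ∃ k, u ∉ LinearMap.range (E ^ k) := by
    obtain ⟨k, hk⟩ := Filter.eventually_atTop.1 E.eventually_disjoint_ker_pow_range_pow
    refine ⟨k + 1, fun hmem => hu.2 ?_⟩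
    refine Submodule.disjoint_def.1 (hk (k + 1) (by omega)) u ?_ hmem
    rw [LinearMap.mem_ker, pow_succ, Module.End.mul_apply, hEu, map_zero]
  classical
  obtain ⟨n, hn, hmin⟩ : ∃ n, u ∉ LinearMap.range (E ^ n) ∧
      ∀ m < n, u ∈ LinearMap.range (E ^ m) :=
    ⟨Nat.find hex, Nat.find_spec hex, fun m hm => not_not.1 (Nat.find_min hex hm)⟩
  have hn0 : 0 < n := by
    refine Nat.pos_of_ne_zero ?_
    rintro rfl
    exact hn ⟨u, by simp⟩
  obtain ⟨x, hx⟩ := hmin (n - 1) (by omega)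
  have hEx : (E ^ n) x = 0 := by
    rw [← Nat.sub_add_cancel hn0, pow_succ', Module.End.mul_apply, hx, hEu]
  obtain ⟨f, hfu, hf⟩ := Submodule.exists_le_ker_of_notMem hn
  obtain ⟨y, hyu, hy⟩ : ∃ y, B u y = 1 ∧ ∀ a, B ((E ^ n) a) y = 0 := by
    obtain ⟨y, rfl⟩ := hsurj f
    rw [LinearMap.flip_apply] at hfu
    refine ⟨(B u y)⁻¹ • y, by simp [hfu], fun a => ?_⟩
    have : B ((E ^ n) a) y = 0 := hf ⟨a, rfl⟩
    simp [this]
  have hFy : (F ^ n) y = 0 := h _ fun a => by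
    rw [← pow_apply_apply hT hTE hTF, hy]
  have hxy : B ((E ^ (n - 1)) x) y = 1 := by rw [hx, hyu]
  by_cases hμn : μ = (-1) ^ (n + 1)
  · have hμ2 : μ ^ 2 = 1 := by
      rw [hμn, ← pow_mul, mul_comm, pow_mul]
      simp
    have hEy : (E ^ n) y = 0 := by
      have h1 : E = (-μ) • (P * F) := by
        ext v
        rw [LinearMap.smul_apply, Module.End.mul_apply, hE, hF, map_sub, hPT, map_smul, smul_sub,
          smul_smul, neg_mul, ← sq, hμ2]
        module
      have h2 : Commute P F := by
        refine Commute.sub_right ?_ ((Commute.one_right P).smul_right _)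
        ext v
        rw [Module.End.mul_apply, Module.End.mul_apply, hPT, hTP]
      rw [h1, smul_pow, h2.mul_pow, LinearMap.smul_apply, Module.End.mul_apply, hFy, map_zero,
        smul_zero]
    have hyx : B ((E ^ (n - 1)) y) x = 1 := by
      have hrec := apply_pow_apply_pow_recursion (apply_add_apply_add hT hTE) x y
      have hl : ∀ i j, n ≤ i → B ((E ^ i) x) ((E ^ j) y) = 0 := fun i j hi => by
        simp [pow_apply_eq_zero_of_le hEx hi]
      have h1 := eq_pow_mul_of_recursion (g := fun i j => B ((E ^ i) x) ((E ^ j) y)) hμ2 hrec hl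
        (i := 0) (j := n - 1) (by omega)
      have h2 := eq_zero_of_recursion_of_le (g := fun i j => B ((E ^ i) x) ((E ^ j) y)) hμ2 hrec hl
        (i := 1) (j := n - 1) (by omega)
      simp only [pow_zero, pow_one, Module.End.one_apply, hxy] at h1 h2
      have h3 := hT (μ • x + E x) ((E ^ (n - 1)) y)
      rw [hTE] at h3
      rw [← h3, map_add, map_smul, LinearMap.add_apply, LinearMap.smul_apply, h1, h2, hμn,
        mul_one, add_zero, smul_eq_mul, ← pow_add, show n + 1 + (n - 1) = 2 * n by omega, pow_mul]
      simp
    obtain ⟨z, hz, hzz⟩ : ∃ z, (E ^ n) z = 0 ∧ B ((E ^ (n - 1)) z) z ≠ 0 := by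
      by_contra! hc
      have h1 := hc (x + y) (by rw [map_add, hEx, hEy, add_zero])
      simp only [map_add, LinearMap.add_apply, hc x hEx, hc y hEy, hxy, hyx] at h1
      norm_num at h1
    exact hasCanonicalBasis_of_self_dual_chain hT hTE hn0 hμn hz hzz hW
  · exact hasCanonicalBasis_of_dual_chains hT hTE hTF hn0 hμ0 hμn hEx hFy hxy hW

end Nondegenerate

/-- Every bilinear form on a finite-dimensional complex vector space has a canonical basis. -/
theorem hasCanonicalBasis (k : ℕ) : ∀ (V : Type u) [AddCommGroup V] [Module ℂ V]
    [FiniteDimensional ℂ V] (B : V →ₗ[ℂ] V →ₗ[ℂ] ℂ), Module.finrank ℂ V = k →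
    HasCanonicalBasis B := by
  induction k using Nat.strong_induction_on with
  | _ k ih =>
  rintro V _ _ _ B rfl
  have hW (W : Submodule ℂ V) (h : W ≠ ⊤) : HasCanonicalBasis (B.domRestrict₁₂ W W) :=
    ih _ (Submodule.finrank_lt h) W _ rfl
  by_cases h : ∃ y, y ≠ 0 ∧ ∀ x, B x y = 0
  · obtain ⟨n, e, he⟩ := exists_isNilpotentChain _ V B rfl h
    exact he.hasCanonicalBasis hW
  push Not at h
  rcases subsingleton_or_nontrivial V with hV | hV
  · exact ⟨Empty, inferInstance, Empty.elim, fun i => i.elim, .empty V, by simp, by simp,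
      by simp⟩
  · refine .of_nondegenerate (fun y hy => ?_) hW
    by_contra hy0
    obtain ⟨x, hx⟩ := h y hy0
    exact hx (hy x)

/-- A canonical basis of the form defined by `A` gives a congruence of `A` to a direct sum of
canonical blocks. -/
theorem HasCanonicalBasis.exists_congruent {N : ℕ} {A : Matrix (Fin N) (Fin N) ℂ}
    (h : HasCanonicalBasis (Matrix.toLinearMap₂' ℂ A)) :
    ∃ (s : ℕ) (d : Fin s → ℕ) (Bk : ∀ i, Matrix (Fin (d i)) (Fin (d i)) ℂ)
      (e : ((i : Fin s) × Fin (d i)) ≃ Fin N) (S : Matrix (Fin N) (Fin N) ℂ),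
      IsUnit S ∧
      Sᵀ * A * S = Matrix.reindex e e (Matrix.blockDiagonal' Bk) ∧
      ∀ i, IsCanonicalBlock (Bk i) := by
  obtain ⟨ι, _, d, Bk, b, hb, hb', hBk⟩ := h
  let e₀ := (Fintype.equivFin ι).symm
  let b' := b.reindex (Equiv.sigmaCongrLeft (β := fun i => Fin (d i)) e₀).symm
  let e : ((i : Fin (Fintype.card ι)) × Fin (d (e₀ i))) ≃ Fin N :=
    b'.indexEquiv (Pi.basisFun ℂ (Fin N))
  have hb'' (i p) : b' ⟨i, p⟩ = b ⟨e₀ i, p⟩ := by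
    simp [b']
  refine ⟨Fintype.card ι, fun i => d (e₀ i), fun i => Bk (e₀ i), e,
    (Pi.basisFun ℂ (Fin N)).toMatrix (b'.reindex e), ?_, ?_, fun i => hBk _⟩
  · exact IsUnit.of_mul_eq_one _ (Module.Basis.toMatrix_mul_toMatrix_flip _ _)
  · ext i j
    obtain ⟨⟨i, p⟩, rfl⟩ := e.surjective i
    obtain ⟨⟨j, q⟩, rfl⟩ := e.surjective j
    trans Matrix.toLinearMap₂' ℂ A (b' ⟨i, p⟩) (b' ⟨j, q⟩)
    · rw [Matrix.toLinearMap₂'_apply']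
      simp [Matrix.mul_apply, Module.Basis.toMatrix_apply, dotProduct, Matrix.mulVec,
        Finset.sum_mul, Finset.mul_sum, mul_assoc]
      exact Finset.sum_comm
    · rw [hb'', hb'']
      simp only [Matrix.reindex_apply, Matrix.submatrix_apply, Equiv.symm_apply_apply]
      by_cases hij : i = j
      · subst hij
        rw [hb, Matrix.blockDiagonal'_apply_eq]
      · rw [hb' _ _ _ _ fun h => hij (e₀.injective h), Matrix.blockDiagonal'_apply_ne _ _ _ hij]

/-- Every square complex matrix is congruent to a direct sum of matrices of the forms
`J_n(0)`, `Γ_n`, and `[[0,I_n],[J_n(λ),0]]` with `λ ≠ 0`, `λ ≠ (-1)^{n+1}`. -/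
theorem congruence_canonical_form (N : ℕ) (A : Matrix (Fin N) (Fin N) ℂ) :
    ∃ (s : ℕ) (d : Fin s → ℕ) (Bk : ∀ i, Matrix (Fin (d i)) (Fin (d i)) ℂ)
      (e : ((i : Fin s) × Fin (d i)) ≃ Fin N) (S : Matrix (Fin N) (Fin N) ℂ),
      IsUnit S ∧
      Sᵀ * A * S = Matrix.reindex e e (Matrix.blockDiagonal' Bk) ∧
      ∀ i, Bk i = Jb (d i) 0 ∨ Bk i = Gam (d i) ∨
        ∃ (m : ℕ) (μ : ℂ) (h : m + m = d i), μ ≠ 0 ∧ μ ≠ (-1 : ℂ) ^ (m + 1) ∧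
          Bk i = Matrix.reindex (finCongr h) (finCongr h) (PairBlk m μ) := by
  exact (hasCanonicalBasis _ _ _ rfl).exists_congruent
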